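/- Assume ℱ_0 is trivial and Z_0 is deterministic, and suppose there are deterministic reals ε_t ≥ 0 with ∑_{t=0}^∞ ε_t < ∞ such that 0 ≤ Z_{t+1} − Z_t ≤ ε_t a.s. for all t ≥ 0. For t ≥ 1 define S_t := σ_2(σ_3(⋯σ_t(Z_t − Z_0)⋯)) (so S_1 = Z_1 − Z_0). Then ρ_∞(Z) := lim_{t→∞} ρ_t(Z_t) exists, the sequence (S_t) converges uniformly (in essential sup norm) to a bounded random variable S, and ρ_∞(Z) = Z_0 + σ_1(S). -/

import Mathlib

open MeasureTheory Filter

/-- A bounded real-valued function (bounded random variable). -/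
def Bdd {Ω : Type*} (X : Ω → ℝ) : Prop := ∃ C : ℝ, ∀ ω, |X ω| ≤ C

/-- Nested application of the conditional risk mappings:
`nest σ i n X = σ (i+1) (σ (i+2) (⋯ (σ (i+n) X) ⋯))`, so that the nested risk measure of the
paper is `ρ_t(X) = nest σ 0 t X = σ 1 (σ 2 (⋯ (σ t X) ⋯))`. -/
def nest {Ω : Type*} (σ : ℕ → (Ω → ℝ) → (Ω → ℝ)) : ℕ → ℕ → (Ω → ℝ) → (Ω → ℝ)
  | _, 0, X => X
  | i, n + 1, X => σ (i + 1) (nest σ (i + 1) n X)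

theorem nrd_bdd_sub {Ω : Type*} {X Y : Ω → ℝ} (hX : Bdd X) (hY : Bdd Y) :
    Bdd (fun ω => X ω - Y ω) := by
  obtain ⟨a, ha⟩ := hX
  obtain ⟨b, hb⟩ := hY
  exact ⟨a + b, fun ω => (abs_sub _ _).trans (add_le_add (ha ω) (hb ω))⟩

theorem nrd_bdd_const {Ω : Type*} (c : ℝ) : Bdd (fun _ : Ω => c) := ⟨|c|, fun _ => le_rfl⟩

theorem nrd_bdd_add {Ω : Type*} {X Y : Ω → ℝ} (hX : Bdd X) (hY : Bdd Y) :
    Bdd (fun ω => X ω + Y ω) := by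
  obtain ⟨a, ha⟩ := hX
  obtain ⟨b, hb⟩ := hY
  exact ⟨a + b, fun ω => (abs_add_le _ _).trans (add_le_add (ha ω) (hb ω))⟩

theorem nrd_nest_bdd {Ω : Type*} (σ : ℕ → (Ω → ℝ) → (Ω → ℝ))
    (hσ_bdd : ∀ t, 1 ≤ t → ∀ X : Ω → ℝ, Bdd X → Bdd (σ t X)) (n : ℕ) :
    ∀ (i : ℕ) (X : Ω → ℝ), Bdd X → Bdd (nest σ i n X) := by
  induction n with
  | zero => intro i X hX; exact hX
  | succ n ih => intro i X hX; exact hσ_bdd _ (by omega) _ (ih _ _ hX)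

theorem nrd_nest_succ {Ω : Type*} (σ : ℕ → (Ω → ℝ) → (Ω → ℝ)) (n : ℕ) :
    ∀ (i : ℕ) (X : Ω → ℝ), nest σ i (n + 1) X = nest σ i n (σ (i + n + 1) X) := by
  induction n with
  | zero => intro i X; rfl
  | succ n ih =>
    intro i X
    change σ (i + 1) (nest σ (i + 1) (n + 1) X) = σ (i + 1) (nest σ (i + 1) n _)
    rw [ih, show i + 1 + n + 1 = i + (n + 1) + 1 by omega]

/-- Assume `ℱ_0` is trivial, `Z_0 = z₀` is deterministic, and
`0 ≤ Z_{t+1} − Z_t ≤ ε_t` a.s. with deterministic `ε_t ≥ 0`, `∑ ε_t < ∞`.  With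
`S_t = σ_2(σ_3(⋯ σ_t(Z_t − Z_0) ⋯)) = nest σ 1 (t-1) (Z_t − Z_0)` for `t ≥ 1`, the limit
`ρ_∞(Z) = lim_t ρ_t(Z_t)` exists, `(S_t)` converges uniformly (in essential sup norm) to a
bounded random variable `S`, and `ρ_∞(Z) = Z_0 + σ_1(S)` (a.s., both sides being
deterministic since `ℱ_0` is trivial). -/
theorem nested_risk_decomposition
    {Ω : Type*} {mΩ : MeasurableSpace Ω} (P : Measure Ω) [IsProbabilityMeasure P]
    (F : ℕ → MeasurableSpace Ω) (hF_mono : Monotone F) (hF_le : ∀ t, F t ≤ mΩ)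
    (σ : ℕ → (Ω → ℝ) → (Ω → ℝ))
    (hσ_bdd : ∀ t, 1 ≤ t → ∀ X : Ω → ℝ, Bdd X → Bdd (σ t X))
    (hσ_meas : ∀ t, 1 ≤ t → ∀ X : Ω → ℝ, Bdd X → Measurable[F (t - 1)] (σ t X))
    (hσ_mono : ∀ t, 1 ≤ t → ∀ X Y : Ω → ℝ, Bdd X → Bdd Y →
      (∀ᵐ ω ∂P, X ω ≤ Y ω) → ∀ᵐ ω ∂P, σ t X ω ≤ σ t Y ω)
    (hσ_trans : ∀ t, 1 ≤ t → ∀ X C : Ω → ℝ, Bdd X → Bdd C → Measurable[F (t - 1)] C →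
      σ t (fun ω => X ω + C ω) =ᵐ[P] fun ω => σ t X ω + C ω)
    (hσ_supp : ∀ t, 1 ≤ t → ∀ X : Ω → ℝ, Bdd X →
      ∀ᵐ ω ∂P, essInf X P ≤ σ t X ω ∧ σ t X ω ≤ essSup X P)
    (hF0 : F 0 = ⊥)
    (Z : ℕ → Ω → ℝ)
    (hZ_meas : ∀ t, Measurable[F t] (Z t))
    (hZ_bdd : ∀ t, Bdd (Z t))
    (z₀ : ℝ) (hZ0 : Z 0 = fun _ => z₀)
    (ε : ℕ → ℝ) (hε_nonneg : ∀ t, 0 ≤ ε t) (hε_sum : Summable ε)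
    (hZ_inc : ∀ t : ℕ, ∀ᵐ ω ∂P, 0 ≤ Z (t + 1) ω - Z t ω ∧ Z (t + 1) ω - Z t ω ≤ ε t) :
    ∃ (L : ℝ) (S : Ω → ℝ), Bdd S ∧
      (∀ᵐ ω ∂P, Tendsto (fun t => nest σ 0 t (Z t) ω) atTop (nhds L)) ∧
      Tendsto
        (fun t =>
          essSup (fun ω => |nest σ 1 t (fun ω' => Z (t + 1) ω' - Z 0 ω') ω - S ω|) P)
        atTop (nhds 0) ∧
      (∀ᵐ ω ∂P, z₀ + σ 1 S ω = L) := by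
  have hle1 : ∀ t, 1 ≤ t → ∀ (X Y : Ω → ℝ) (c : ℝ), Bdd X → Bdd Y →
      (∀ᵐ ω ∂P, X ω ≤ Y ω + c) → ∀ᵐ ω ∂P, σ t X ω ≤ σ t Y ω + c := by
    intro t ht X Y c hX hY h
    have h1 := hσ_mono t ht X (fun ω => Y ω + c) hX (nrd_bdd_add hY (nrd_bdd_const c)) h
    have h2 := hσ_trans t ht Y (fun _ => c) hY (nrd_bdd_const c) measurable_const
    filter_upwards [h1, h2] with ω a b
    rw [b] at a
    exact a
  have hleN : ∀ n i (X Y : Ω → ℝ) (c : ℝ), Bdd X → Bdd Y →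
      (∀ᵐ ω ∂P, X ω ≤ Y ω + c) → ∀ᵐ ω ∂P, nest σ i n X ω ≤ nest σ i n Y ω + c := by
    intro n
    induction n with
    | zero => intro i X Y c hX hY h; exact h
    | succ n ih =>
      intro i X Y c hX hY h
      exact hle1 _ (by omega) _ _ c (nrd_nest_bdd σ hσ_bdd n _ _ hX)
        (nrd_nest_bdd σ hσ_bdd n _ _ hY) (ih _ X Y c hX hY h)
  have hfix : ∀ t, 1 ≤ t → ∀ C : Ω → ℝ, Bdd C → Measurable[F (t - 1)] C →
      σ t C =ᵐ[P] C := by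
    intro t ht C hC hCm
    have h1 := hσ_trans t ht (fun _ => 0) C (nrd_bdd_const 0) hC hCm
    have h2 := hσ_supp t ht (fun _ => 0) (nrd_bdd_const 0)
    have hne : P ≠ 0 := IsProbabilityMeasure.ne_zero P
    rw [essInf_const _ hne, essSup_const _ hne] at h2
    simp only [zero_add] at h1
    filter_upwards [h1, h2] with ω a b
    have : σ t (fun _ => 0) ω = 0 := le_antisymm b.2 b.1
    rw [a, this, zero_add]
  have hWb : ∀ t, Bdd (fun ω => Z t ω - Z 0 ω) := fun t => nrd_bdd_sub (hZ_bdd t) (hZ_bdd 0)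
  have hWm : ∀ t, Measurable[F t] (fun ω => Z t ω - Z 0 ω) := by
    intro t
    rw [hZ0]
    exact (hZ_meas t).sub_const z₀
  let T : ℕ → Ω → ℝ := fun t => nest σ 1 t (fun ω' => Z (t + 1) ω' - Z 0 ω')
  have hTb : ∀ t, Bdd (T t) := fun t => nrd_nest_bdd σ hσ_bdd t _ _ (hWb _)
  have hstep : ∀ t, ∀ᵐ ω ∂P, dist (T t ω) (T (t + 1) ω) ≤ ε (t + 1) := by
    intro t
    have hT : T (t + 1) = nest σ 1 t (σ (t + 2) (fun ω' => Z (t + 2) ω' - Z 0 ω')) := by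
      change nest σ 1 (t + 1) _ = _
      rw [nrd_nest_succ, show 1 + t + 1 = t + 2 by omega]
    have hb := hσ_bdd (t + 2) (by omega) _ (hWb (t + 2))
    have hf := hfix (t + 2) (by omega) _ (hWb (t + 1)) (hWm (t + 1))
    have hu := hle1 (t + 2) (by omega) _ _ (ε (t + 1)) (hWb (t + 2)) (hWb (t + 1)) (by
      filter_upwards [hZ_inc (t + 1)] with ω h
      have := h.2
      change Z (t + 1 + 1) ω - Z 0 ω ≤ _
      linarith)
    have hl := hle1 (t + 2) (by omega) _ _ 0 (hWb (t + 1)) (hWb (t + 2)) (by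
      filter_upwards [hZ_inc (t + 1)] with ω h
      have := h.1
      change _ ≤ Z (t + 1 + 1) ω - Z 0 ω + 0
      linarith)
    have hu' := hleN t 1 _ _ (ε (t + 1)) hb (hWb (t + 1)) (by
      filter_upwards [hf, hu] with ω a b
      rw [a] at b
      exact b)
    have hl' := hleN t 1 _ _ 0 (hWb (t + 1)) hb (by
      filter_upwards [hf, hl] with ω a b
      rw [a] at b
      exact b)
    filter_upwards [hu', hl'] with ω a b
    rw [hT, Real.dist_eq, abs_le]
    have := hε_nonneg (t + 1)
    change _ ≤ T t ω + _ at a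
    change T t ω ≤ _ at b
    constructor <;> linarith
  have hsum : Summable (fun t => ε (t + 1)) := (summable_nat_add_iff 1).2 hε_sum
  let tail : ℕ → ℝ := fun n => ∑' m, ε (n + m + 1)
  have htail : Tendsto tail atTop (nhds 0) := by
    have := tendsto_sum_nat_add (fun t => ε (t + 1))
    refine this.congr fun n => ?_
    simp only [tail, add_comm n]
  have hlim : ∀ ω, (∀ t, dist (T t ω) (T (t + 1) ω) ≤ ε (t + 1)) →
      ∃ a, ∀ n, dist (T n ω) a ≤ tail n := by
    intro ω h
    obtain ⟨a, ha⟩ := cauchySeq_tendsto_of_complete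
      (cauchySeq_of_dist_le_of_summable _ h hsum)
    exact ⟨a, fun n => dist_le_tsum_of_dist_le_of_tendsto _ h hsum ha n⟩
  classical
  let S : Ω → ℝ := fun ω =>
    if h : ∀ t, dist (T t ω) (T (t + 1) ω) ≤ ε (t + 1) then (hlim ω h).choose else T 0 ω
  have htail0 : ∀ n, 0 ≤ tail n := fun n => tsum_nonneg fun m => hε_nonneg _
  have hS0 : ∀ ω, |T 0 ω - S ω| ≤ tail 0 := by
    intro ω
    by_cases h : ∀ t, dist (T t ω) (T (t + 1) ω) ≤ ε (t + 1)
    · simp only [S, dif_pos h]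
      exact (hlim ω h).choose_spec 0
    · simp only [S, dif_neg h, sub_self, abs_zero]
      exact htail0 0
  have hS : ∀ᵐ ω ∂P, ∀ n, |T n ω - S ω| ≤ tail n := by
    filter_upwards [ae_all_iff.2 hstep] with ω h n
    simp only [S, dif_pos h]
    exact (hlim ω h).choose_spec n
  have hSb : Bdd S := by
    obtain ⟨C, hC⟩ := hTb 0
    refine ⟨C + tail 0, fun ω => ?_⟩
    have h1 := abs_le.1 (hS0 ω)
    have h2 := abs_le.1 (hC ω)
    exact abs_le.2 ⟨by linarith, by linarith⟩
  obtain ⟨c, hc⟩ : ∃ c, σ 1 S = fun _ => c := by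
    have h := hσ_meas 1 le_rfl S hSb
    rw [Nat.sub_self, hF0] at h
    exact eq_const_of_measurable_bot h
  refine ⟨z₀ + c, S, hSb, ?_, ?_, ?_⟩
  · have hρ : ∀ t, ∀ᵐ ω ∂P, |nest σ 0 (t + 1) (Z (t + 1)) ω - (z₀ + c)| ≤ tail t := by
      intro t
      have hNb := nrd_nest_bdd σ hσ_bdd t 1 _ (hZ_bdd (t + 1))
      have h1 := hleN t 1 _ _ z₀ (hZ_bdd (t + 1)) (hWb (t + 1)) (by
        filter_upwards with ω
        simp [hZ0])
      have h2 := hleN t 1 _ _ (-z₀) (hWb (t + 1)) (hZ_bdd (t + 1)) (by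
        filter_upwards with ω
        simp [hZ0, sub_eq_add_neg])
      have h3 := hle1 1 le_rfl _ S (z₀ + tail t) hNb hSb (by
        filter_upwards [h1, hS] with ω a b
        have := (abs_le.1 (b t)).2
        change _ ≤ T t ω + _ at a
        linarith)
      have h4 := hle1 1 le_rfl S _ (-z₀ + tail t) hSb hNb (by
        filter_upwards [h2, hS] with ω a b
        have := (abs_le.1 (b t)).1
        change T t ω ≤ _ at a
        linarith)
      filter_upwards [h3, h4] with ω a b
      rw [hc] at a b
      change |σ 1 (nest σ 1 t (Z (t + 1))) ω - _| ≤ _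
      exact abs_le.2 ⟨by linarith, by linarith⟩
    filter_upwards [ae_all_iff.2 hρ] with ω h
    rw [← tendsto_add_atTop_iff_nat 1, tendsto_iff_dist_tendsto_zero]
    exact squeeze_zero (fun _ => dist_nonneg) h htail
  · have hub : ∀ t, essSup (fun ω => |T t ω - S ω|) P ≤ tail t := by
      intro t
      refine essSup_le_of_ae_le _ (hS.mono fun ω h => h t) ?_
      exact isCoboundedUnder_le_of_le _ (x := 0) fun ω => abs_nonneg _
    have hlb : ∀ t, 0 ≤ essSup (fun ω => |T t ω - S ω|) P := by
      intro t
      refine le_limsup_of_frequently_le (Frequently.of_forall fun ω => abs_nonneg _) ?_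
      exact ⟨tail t, eventually_map.2 (hS.mono fun ω h => h t)⟩
    exact squeeze_zero hlb hub htail
  · simp [hc]
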